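/- With the expectation over independent uniform sample indices written as a finite average, one has (1/2) · (1/∏_{i=1}^{n} m_i) · ∑_{s_1=1}^{m_1} ⋯ ∑_{s_n=1}^{m_n} ‖ (1/n)·∑_{i=1}^{n} v_i(s_i) ‖² ≤ ‖∇f(x̄)‖² + (2L²/n)·∑_{i=1}^{n} ( 3‖x_i − x̄‖² + 2‖τ_i − x̄‖² ). -/

import Mathlib

section Averages

variable {E : Type*} [NormedAddCommGroup E] [InnerProductSpace ℝ E]

theorem norm_add_sq_le_two_mul (a b : E) : ‖a + b‖ ^ 2 ≤ 2 * ‖a‖ ^ 2 + 2 * ‖b‖ ^ 2 := by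
  have h := parallelogram_law_with_norm ℝ a b
  nlinarith [sq_nonneg ‖a - b‖]

theorem norm_sq_average_le {ι : Type*} [Fintype ι] (w : ι → E) :
    ‖(Fintype.card ι : ℝ)⁻¹ • ∑ i, w i‖ ^ 2 ≤ (Fintype.card ι : ℝ)⁻¹ * ∑ i, ‖w i‖ ^ 2 := by
  have hsum : ‖∑ i, w i‖ ^ 2 ≤ (Fintype.card ι : ℝ) * ∑ i, ‖w i‖ ^ 2 :=
    (pow_le_pow_left₀ (norm_nonneg _) (norm_sum_le _ _) 2).trans sq_sum_le_card_mul_sum_sq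
  rcases (Nat.cast_nonneg (α := ℝ) (Fintype.card ι)).eq_or_lt with h0 | hpos
  · simp [← h0]
  · rw [norm_smul, mul_pow, Real.norm_of_nonneg (by positivity)]
    calc _ ≤ ((Fintype.card ι : ℝ)⁻¹) ^ 2 * ((Fintype.card ι : ℝ) * ∑ i, ‖w i‖ ^ 2) := by gcongr
      _ = _ := by field_simp

theorem sum_norm_sub_average_sq_le {ι : Type*} [Fintype ι] (z : ι → E) :
    ∑ j, ‖z j - (Fintype.card ι : ℝ)⁻¹ • ∑ k, z k‖ ^ 2 ≤ ∑ j, ‖z j‖ ^ 2 := by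
  rcases isEmpty_or_nonempty ι with _ | _
  · simp
  set c := (Fintype.card ι : ℝ)⁻¹ • ∑ k, z k with hc
  have hcard : (Fintype.card ι : ℝ) ≠ 0 := by simp
  have hz : ∑ k, z k = (Fintype.card ι : ℝ) • c := by
    rw [hc, smul_smul, mul_inv_cancel₀ hcard, one_smul]
  simp_rw [norm_sub_sq_real]
  rw [Finset.sum_add_distrib, Finset.sum_sub_distrib, ← Finset.mul_sum, ← sum_inner, hz,
    real_inner_smul_left, real_inner_self_eq_norm_sq]
  simp only [Finset.sum_const, Finset.card_univ, nsmul_eq_mul]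
  have : 0 ≤ (Fintype.card ι : ℝ) * ‖c‖ ^ 2 := by positivity
  linarith

theorem average_norm_add_centered_sq_le {ι : Type*} [Fintype ι] {u z : ι → E} {A B : ℝ}
    (hu : ∀ j, ‖u j‖ ≤ A) (hz : ∀ j, ‖z j‖ ≤ B) :
    (Fintype.card ι : ℝ)⁻¹ * ∑ j, ‖u j + (z j - (Fintype.card ι : ℝ)⁻¹ • ∑ k, z k)‖ ^ 2
      ≤ 2 * A ^ 2 + 2 * B ^ 2 := by
  have hsum : ∑ j, ‖u j + (z j - (Fintype.card ι : ℝ)⁻¹ • ∑ k, z k)‖ ^ 2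
      ≤ (Fintype.card ι : ℝ) * (2 * A ^ 2 + 2 * B ^ 2) :=
    calc _ ≤ ∑ j, (2 * ‖u j‖ ^ 2 + 2 * ‖z j - (Fintype.card ι : ℝ)⁻¹ • ∑ k, z k‖ ^ 2) :=
          Finset.sum_le_sum fun j _ => norm_add_sq_le_two_mul _ _
      _ ≤ ∑ j, (2 * ‖u j‖ ^ 2 + 2 * ‖z j‖ ^ 2) := by
          simp only [Finset.sum_add_distrib, ← Finset.mul_sum]
          gcongr _ + 2 * ?_
          exact sum_norm_sub_average_sq_le z
      _ ≤ ∑ _j : ι, (2 * A ^ 2 + 2 * B ^ 2) := by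
          gcongr with j
          · exact hu j
          · exact hz j
      _ = _ := by rw [Finset.sum_const, Finset.card_univ, nsmul_eq_mul]
  exact inv_mul_le_of_le_mul₀ (by positivity) (by positivity) hsum

/-- Averaging a function of one coordinate over a product of finite types. -/
theorem average_pi_apply {ι : Type*} [Fintype ι] [DecidableEq ι] {κ : ι → Type*}
    [∀ i, Fintype (κ i)] [∀ i, Nonempty (κ i)] (i : ι) (g : κ i → ℝ) :
    (∏ k, (Fintype.card (κ k) : ℝ))⁻¹ * ∑ s : (k : ι) → κ k, g (s i)
      = (Fintype.card (κ i) : ℝ)⁻¹ * ∑ j, g j := by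
  let h : (k : ι) → κ k → ℝ := Function.update (fun _ _ => 1) i g
  have hi : h i = g := Function.update_self ..
  have hne : ∀ k, k ≠ i → h k = fun _ => 1 := fun k hk => Function.update_of_ne hk ..
  have hprod : ∀ s : (k : ι) → κ k, ∏ k, h k (s k) = g (s i) := fun s => by
    rw [Fintype.prod_eq_single i fun k hk => by rw [hne k hk], hi]
  simp_rw [← hprod, ← Fintype.prod_sum, ← Finset.prod_inv_distrib, ← Finset.prod_mul_distrib]
  rw [Fintype.prod_eq_single i, hi]
  intro k hk
  simp [hne k hk]

end Averages

theorem gradient_const_mul_sum {E : Type*} [NormedAddCommGroup E] [InnerProductSpace ℝ E]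
    [CompleteSpace E] {ι : Type*} [Fintype ι] {G : ι → E → ℝ} {g : E → ℝ} {c : ℝ}
    (hG : ∀ i, Differentiable ℝ (G i)) (hg : ∀ y, g y = c * ∑ i, G i y) (y : E) :
    gradient g y = c • ∑ i, gradient (G i) y := by
  apply HasGradientAt.gradient
  rw [hasGradientAt_iff_hasFDerivAt, map_smul, map_sum, funext hg]
  exact (HasFDerivAt.fun_sum fun i _ => (hG i y).hasGradientAt.hasFDerivAt).const_mul c


theorem vr_estimator_average_second_moment_bound
    (d n : ℕ) (hd : 1 ≤ d) (hn : 1 ≤ n) (L : ℝ) (hL : 0 < L)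
    (m : Fin n → ℕ) (hm : ∀ i, 1 ≤ m i)
    (F : (i : Fin n) → Fin (m i) → EuclideanSpace ℝ (Fin d) → ℝ)
    (hFdiff : ∀ i j, Differentiable ℝ (F i j))
    (hFlip : ∀ i j x' y', ‖gradient (F i j) x' - gradient (F i j) y'‖ ≤ L * ‖x' - y'‖)
    (fi : Fin n → EuclideanSpace ℝ (Fin d) → ℝ)
    (hfi : ∀ i x', fi i x' = (m i : ℝ)⁻¹ * ∑ j, F i j x')
    (f : EuclideanSpace ℝ (Fin d) → ℝ)
    (hf : ∀ x', f x' = (n : ℝ)⁻¹ * ∑ i, fi i x')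
    (x τ : Fin n → EuclideanSpace ℝ (Fin d))
    (xbar : EuclideanSpace ℝ (Fin d)) (hxbar : xbar = (n : ℝ)⁻¹ • ∑ i, x i)
    (vv : (i : Fin n) → Fin (m i) → EuclideanSpace ℝ (Fin d))
    (hvv : ∀ i j, vv i j
        = gradient (F i j) (x i) - gradient (F i j) (τ i) + gradient (fi i) (τ i)) :
    (1 / 2) * ((∏ i, (m i : ℝ))⁻¹ * ∑ sf : (i : Fin n) → Fin (m i),
        ‖(n : ℝ)⁻¹ • ∑ i, vv i (sf i)‖ ^ 2)
      ≤ ‖gradient f xbar‖ ^ 2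
        + (2 * L ^ 2 / (n : ℝ)) * ∑ i,
            (3 * ‖x i - xbar‖ ^ 2 + 2 * ‖τ i - xbar‖ ^ 2) := by
  have hnonempty : ∀ i, Nonempty (Fin (m i)) := fun i => ⟨⟨0, hm i⟩⟩
  have hfidiff : ∀ i, Differentiable ℝ (fi i) := fun i => by
    rw [funext (hfi i)]
    exact (Differentiable.fun_sum fun j _ => hFdiff i j).const_mul _
  have hgradfi : ∀ i y, gradient (fi i) y = (m i : ℝ)⁻¹ • ∑ j, gradient (F i j) y :=
    fun i y => gradient_const_mul_sum (hFdiff i) (hfi i) y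
  have hgradf : gradient f xbar = (n : ℝ)⁻¹ • ∑ i, gradient (fi i) xbar :=
    gradient_const_mul_sum hfidiff hf xbar
  let w : (i : Fin n) → Fin (m i) → EuclideanSpace ℝ (Fin d) :=
    fun i j => vv i j - gradient (fi i) xbar
  have hw : ∀ i, (m i : ℝ)⁻¹ * ∑ j, ‖w i j‖ ^ 2
      ≤ 2 * (L * ‖x i - xbar‖) ^ 2 + 2 * (L * ‖τ i - xbar‖) ^ 2 := fun i => by
    have h := average_norm_add_centered_sq_le (ι := Fin (m i))
      (u := fun j => gradient (F i j) (x i) - gradient (F i j) xbar)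
      (z := fun j => gradient (F i j) xbar - gradient (F i j) (τ i))
      (A := L * ‖x i - xbar‖) (B := L * ‖τ i - xbar‖)
      (fun j => hFlip i j _ _) (fun j => norm_sub_rev (τ i) xbar ▸ hFlip i j _ _)
    simp only [Fintype.card_fin, Finset.sum_sub_distrib, smul_sub, ← hgradfi] at h
    have hwij : ∀ j, w i j = gradient (F i j) (x i) - gradient (F i j) xbar
        + (gradient (F i j) xbar - gradient (F i j) (τ i)
          - (gradient (fi i) xbar - gradient (fi i) (τ i))) := fun j => by
      simp only [w, hvv]
      abel
    simpa only [hwij] using h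
  have hpoint : ∀ s : (i : Fin n) → Fin (m i), ‖(n : ℝ)⁻¹ • ∑ i, vv i (s i)‖ ^ 2
      ≤ 2 * ‖gradient f xbar‖ ^ 2 + 2 * ((n : ℝ)⁻¹ * ∑ i, ‖w i (s i)‖ ^ 2) := fun s => by
    have hsplit : (n : ℝ)⁻¹ • ∑ i, vv i (s i)
        = gradient f xbar + (n : ℝ)⁻¹ • ∑ i, w i (s i) := by
      simp only [w, hgradf, Finset.sum_sub_distrib, smul_sub]
      abel
    rw [hsplit]
    refine (norm_add_sq_le_two_mul _ _).trans ?_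
    gcongr
    simpa using norm_sq_average_le fun i => w i (s i)
  have hP : (∏ i, (m i : ℝ)) ≠ 0 :=
    Finset.prod_ne_zero_iff.2 fun i _ => Nat.cast_ne_zero.2 (Nat.one_le_iff_ne_zero.1 (hm i))
  have havg : ∀ i, (∏ k, (m k : ℝ))⁻¹ * ∑ s : (k : Fin n) → Fin (m k), ‖w i (s i)‖ ^ 2
      = (m i : ℝ)⁻¹ * ∑ j, ‖w i j‖ ^ 2 := fun i => by
    simpa using average_pi_apply (κ := fun k => Fin (m k)) i fun j => ‖w i j‖ ^ 2
  calc
    _ ≤ (1 / 2) * ((∏ i, (m i : ℝ))⁻¹ * ∑ s : (i : Fin n) → Fin (m i),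
          (2 * ‖gradient f xbar‖ ^ 2 + 2 * ((n : ℝ)⁻¹ * ∑ i, ‖w i (s i)‖ ^ 2))) := by
        gcongr with s
        exact hpoint s
    _ = ‖gradient f xbar‖ ^ 2 + (n : ℝ)⁻¹ * ∑ i, ((m i : ℝ)⁻¹ * ∑ j, ‖w i j‖ ^ 2) := by
        simp_rw [← havg, Finset.sum_add_distrib, ← Finset.mul_sum]
        rw [Finset.sum_comm]
        simp only [Finset.sum_const, Finset.card_univ, Fintype.card_pi, Fintype.card_fin,
          nsmul_eq_mul, Nat.cast_prod]
        field_simp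
    _ ≤ ‖gradient f xbar‖ ^ 2 + (n : ℝ)⁻¹ * ∑ i,
          (2 * L ^ 2 * (3 * ‖x i - xbar‖ ^ 2 + 2 * ‖τ i - xbar‖ ^ 2)) := by
        gcongr _ + _ * ?_
        refine Finset.sum_le_sum fun i _ => (hw i).trans ?_
        nlinarith [sq_nonneg (L * ‖x i - xbar‖), sq_nonneg (L * ‖τ i - xbar‖)]
    _ = _ := by
        rw [← Finset.mul_sum]
        ring
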